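/- arXiv:2201.08899 — 2 statements merged into one kernel-verified Lean document; each statement's English description precedes it below -/
import Mathlib

section
/- Let (Ω, X_n, ℙ_x) be a Markov chain on a nonempty finite set V, and let ∅ ≠ V_1 ⊆ V_2 ⊆ ⋯ ⊆ V_m = V be an increasing sequence of subsets of V. Then for any A ⊆ V and x ∈ V with ℙ_x(τ_A < ∞) = 1, the random finite paths 𝔏(X|_{[0,τ_A]}) and 𝔏_{V_m} ∘ ⋯ ∘ 𝔏_{V_2} ∘ 𝔏_{V_1}(X|_{[0,τ_A]}) have the same distribution; equivalently, for every finite path w on V, ℙ_x(𝔏(X|_{[0,τ_A]}) = w) = ℙ_x(𝔏_{V_m} ∘ ⋯ ∘ 𝔏_{V_2} ∘ 𝔏_{V_1}(X|_{[0,τ_A]}) = w). -/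
open MeasureTheory

namespace LERW

variable {V : Type*} [DecidableEq V]

/-- The suffix of `l` strictly after the last occurrence of `a` in `l`
(`l` itself if `a` does not occur in `l`). -/
def dropToLastOcc (a : V) (l : List V) : List V :=
  (l.reverse.takeWhile (fun z => z ≠ a)).reverse

lemma dropToLastOcc_length_le (a : V) (l : List V) :
    (dropToLastOcc a l).length ≤ l.length := by
  unfold dropToLastOcc
  calc ((l.reverse.takeWhile (fun z => z ≠ a)).reverse).length
      = (l.reverse.takeWhile (fun z => z ≠ a)).length := by simp
    _ ≤ l.reverse.length := (List.takeWhile_sublist _).length_le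
    _ = l.length := by simp

/-- Partial loop erasure `𝔏_S` of a finite path, associated with a set `S` of vertices. -/
def PLE (S : Finset V) : List V → List V
  | [] => []
  | a :: rest =>
    if a ∈ S then
      if a = (a :: rest).getLast (List.cons_ne_nil a rest) then [a]
      else a :: PLE S (dropToLastOcc a rest)
    else
      if rest = [] then [a]
      else a :: PLE S rest
termination_by l => l.length
decreasing_by
  · simpa using Nat.lt_succ_of_le (dropToLastOcc_length_le a rest)
  · simp

variable [Fintype V]

/-- The (full) loop erasure `𝔏 = 𝔏_V`. -/
def LE : List V → List V := PLE Finset.univ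

/-- Iterated partial loop erasure `𝔏_{W m} ∘ ⋯ ∘ 𝔏_{W 2} ∘ 𝔏_{W 1}`. -/
def iterPLE (W : ℕ → Finset V) : ℕ → List V → List V
  | 0, l => l
  | n + 1, l => PLE (W (n + 1)) (iterPLE W n l)

/-- The remaining suffix `w|_{[n_j , η]}` of the loop-erasing walk of `𝔏` the first time
its current value equals `b` (`[]` if this never happens). -/
def LEsuffixAt (b : V) : List V → List V
  | [] => []
  | a :: rest =>
    if a = b then a :: rest
    else if a = (a :: rest).getLast (List.cons_ne_nil a rest) then []
    else LEsuffixAt b (dropToLastOcc a rest)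
termination_by l => l.length
decreasing_by
  simpa using Nat.lt_succ_of_le (dropToLastOcc_length_le a rest)

/-- Entry time `τ_A` into `A ⊆ V`, valued in `ℕ∞`. -/
noncomputable def entryTime (A : Finset V) (ω : ℕ → V) : ℕ∞ :=
  sInf {m : ℕ∞ | ∃ n : ℕ, m = (n : ℕ∞) ∧ ω n ∈ A}

/-- Entry time `τ_A` as a natural number (junk value `0` when `A` is never visited). -/
noncomputable def entryTimeNat (A : Finset V) (ω : ℕ → V) : ℕ :=
  sInf {n : ℕ | ω n ∈ A}

/-- The random finite path `X|_{[0, τ_A]} = (X_0, X_1, …, X_{τ_A})`. -/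
noncomputable def stoppedPath (A : Finset V) (ω : ℕ → V) : List V :=
  (List.range (entryTimeNat A ω + 1)).map ω

/-- Iterated hitting times `τ̊_W^{(n)}` of `W`, valued in `ℕ∞` (with the convention
`τ̊_W^{(0)} = 0`). -/
noncomputable def iterHit (W : Finset V) (ω : ℕ → V) : ℕ → ℕ∞
  | 0 => 0
  | n + 1 => sInf {m : ℕ∞ | ∃ k : ℕ, m = (k : ℕ∞) ∧ iterHit W ω n < (k : ℕ∞) ∧ ω k ∈ W}

/-- The time `τ̊_W^{(n)} ∧ τ_A`, as a natural number. -/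
noncomputable def traceTime (W A : Finset V) (ω : ℕ → V) (n : ℕ) : ℕ :=
  (iterHit W ω n ⊓ entryTime A ω).toNat

variable [MeasurableSpace V]

/-- The trace process `X̃_n = X_{τ̊_W^{(n)} ∧ τ_A}` (so `X̃_0 = X_0`). -/
noncomputable def traceProc (W A : Finset V) (ω : ℕ → V) (n : ℕ) : V :=
  ω (traceTime W A ω n)

/-- The Green function `G_B(x, y) = 𝔼_x(#{0 ≤ n < τ_{V∖B} : X_n = y})`. -/
noncomputable def green (μ : V → Measure (ℕ → V)) (B : Finset V) (x y : V) : ℝ :=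
  ∑' n : ℕ, (μ x {ω | ω n = y ∧ ∀ k ≤ n, ω k ∈ B}).toReal

section Aux

open scoped ENNReal

variable {α : Type*} [DecidableEq α]

lemma dtl_notin (a : α) (r : List α) (h : a ∉ r) : dropToLastOcc a r = r := by
  unfold dropToLastOcc
  rw [List.takeWhile_eq_self_iff.2, List.reverse_reverse]
  intro z hz
  have : z ∈ r := by simpa using hz
  simp only [ne_eq, decide_eq_true_eq]
  rintro rfl
  exact h this

lemma dtl_split (a : α) (N r : List α) (h : a ∉ r) : dropToLastOcc a (N ++ a :: r) = r := by
  unfold dropToLastOcc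
  have h1 : (N ++ a :: r).reverse = r.reverse ++ (a :: N.reverse) := by simp
  rw [h1, List.takeWhile_append_of_pos]
  · simp
  · intro z hz
    have : z ∈ r := by simpa using hz
    simp only [ne_eq, decide_eq_true_eq]
    rintro rfl
    exact h this

lemma last_split (a : α) (r : List α) (h : a ∈ r) : ∃ N r', r = N ++ a :: r' ∧ a ∉ r' := by
  induction r with
  | nil => simp at h
  | cons b r ih =>
    by_cases h' : a ∈ r
    · obtain ⟨N, r', h1, h2⟩ := ih h'
      exact ⟨b :: N, r', by simp [h1], h2⟩
    · have : a = b := by simpa [h'] using h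
      subst this
      exact ⟨[], r, rfl, h'⟩

lemma first_split (a : α) (r : List α) (h : a ∈ r) : ∃ N r', r = N ++ a :: r' ∧ a ∉ N := by
  induction r with
  | nil => simp at h
  | cons b r ih =>
    by_cases hb : a = b
    · subst hb; exact ⟨[], r, rfl, by simp⟩
    · have h' : a ∈ r := by simpa [hb] using h
      obtain ⟨N, r', h1, h2⟩ := ih h'
      exact ⟨b :: N, r', by simp [h1], by simp [hb, h2]⟩

lemma first_uniq (a : α) (N M r s : List α) (h : N ++ a :: r = M ++ a :: s)
    (hN : a ∉ N) (hM : a ∉ M) : N = M ∧ r = s := by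
  induction N generalizing M with
  | nil =>
    cases M with
    | nil => simpa using h
    | cons c M => simp at h hM; exact absurd h.1 hM.1
  | cons b N ih =>
    cases M with
    | nil => simp at h hN; exact absurd h.1.symm hN.1
    | cons c M =>
      simp at h hN hM
      obtain ⟨h1, h2⟩ := ih M h.2 hN.2 hM.2
      exact ⟨by rw [h.1, h1], h2⟩

lemma last_uniq (a : α) (N M r s : List α) (h : N ++ a :: r = M ++ a :: s)
    (hN : a ∉ r) (hM : a ∉ s) : N = M ∧ r = s := by
  have h' := congrArg List.reverse h
  simp only [List.reverse_append, List.reverse_cons, List.append_assoc, List.singleton_append] at h'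
  have := first_uniq a r.reverse s.reverse N.reverse M.reverse (by simpa using h')
    (by simpa using hN) (by simpa using hM)
  exact ⟨List.reverse_injective this.2, List.reverse_injective this.1⟩

lemma tsum_last (a : α) (F : List α → ℝ≥0∞) :
    ∑' r, F r = ∑' r, (if a ∈ r then 0 else F r) +
      ∑' N, ∑' r, (if a ∈ r then 0 else F (N ++ a :: r)) := by
  have h1 : ∀ r, F r = (if a ∈ r then 0 else F r) + (if a ∈ r then F r else 0) := by
    intro r; split_ifs <;> simp
  rw [tsum_congr h1, ENNReal.tsum_add]
  congr 1
  rw [← ENNReal.tsum_prod (f := fun N r => if a ∈ r then 0 else F (N ++ a :: r))]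
  refine tsum_eq_tsum_of_ne_zero_bij (fun p => p.1.1 ++ a :: p.1.2) ?_ ?_ ?_
  · rintro ⟨⟨N, r⟩, hp⟩ ⟨⟨M, s⟩, hq⟩ h
    have hr : a ∉ r := by intro hh; simp [hh] at hp
    have hs : a ∉ s := by intro hh; simp [hh] at hq
    obtain ⟨h1, h2⟩ := last_uniq a N M r s h hr hs
    subst h1; subst h2; rfl
  · intro r hr
    have hr1 : a ∈ r := by by_contra hh; simp [hh] at hr
    have hr2 : F r ≠ 0 := by intro hh; simp [hh] at hr
    obtain ⟨N, s, rfl, h3⟩ := last_split a r hr1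
    exact ⟨⟨(N, s), by simp [h3, hr2]⟩, rfl⟩
  · rintro ⟨⟨N, r⟩, hp⟩
    have hr : a ∉ r := by intro hh; simp [hh] at hp
    simp [hr]

lemma tsum_first (a : α) (F : List α → ℝ≥0∞) :
    ∑' r, F r = ∑' r, (if a ∈ r then 0 else F r) +
      ∑' N, ∑' r, (if a ∈ N then 0 else F (N ++ a :: r)) := by
  have h1 : ∀ r, F r = (if a ∈ r then 0 else F r) + (if a ∈ r then F r else 0) := by
    intro r; split_ifs <;> simp
  rw [tsum_congr h1, ENNReal.tsum_add]
  congr 1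
  rw [← ENNReal.tsum_prod (f := fun N r => if a ∈ N then 0 else F (N ++ a :: r))]
  refine tsum_eq_tsum_of_ne_zero_bij (fun p => p.1.1 ++ a :: p.1.2) ?_ ?_ ?_
  · rintro ⟨⟨N, r⟩, hp⟩ ⟨⟨M, s⟩, hq⟩ h
    have hr : a ∉ N := by intro hh; simp [hh] at hp
    have hs : a ∉ M := by intro hh; simp [hh] at hq
    obtain ⟨h1, h2⟩ := first_uniq a N M r s h hr hs
    subst h1; subst h2; rfl
  · intro r hr
    have hr1 : a ∈ r := by by_contra hh; simp [hh] at hr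
    have hr2 : F r ≠ 0 := by intro hh; simp [hh] at hr
    obtain ⟨N, s, rfl, h3⟩ := first_split a r hr1
    exact ⟨⟨(N, s), by simp [h3, hr2]⟩, rfl⟩
  · rintro ⟨⟨N, r⟩, hp⟩
    have hr : a ∉ N := by intro hh; simp [hh] at hp
    simp [hr]

lemma tsum_cons (a : α) (F : List α → ℝ≥0∞) (h : ∀ l, F l ≠ 0 → ∃ r, l = a :: r) :
    ∑' l, F l = ∑' r, F (a :: r) := by
  symm
  have hinj : Function.Injective (fun r : List α => a :: r) := fun r s h => by simpa using h
  refine hinj.tsum_eq ?_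
  intro l hl
  obtain ⟨r, rfl⟩ := h l hl
  exact ⟨r, rfl⟩

/-- simplified erasure, for the path without its endpoint -/
def EE (S : Finset α) : List α → List α
  | [] => []
  | a :: rest => a :: EE S (if a ∈ S then dropToLastOcc a rest else rest)
termination_by l => l.length
decreasing_by
  split_ifs
  · simpa using Nat.lt_succ_of_le (dropToLastOcc_length_le a rest)
  · simp

lemma EE_nil (S : Finset α) : EE S [] = [] := by rw [EE]

lemma EE_cons (S : Finset α) (a : α) (r : List α) :
    EE S (a :: r) = a :: EE S (if a ∈ S then dropToLastOcc a r else r) := by rw [EE]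

lemma EE_eq_nil (S : Finset α) (l : List α) : EE S l = [] ↔ l = [] := by
  cases l with
  | nil => simp [EE_nil]
  | cons a r => simp [EE_cons]

lemma dtl_sub (a : α) (l : List α) : ∀ y ∈ dropToLastOcc a l, y ∈ l := by
  intro y hy
  unfold dropToLastOcc at hy
  rw [List.mem_reverse] at hy
  simpa using (List.takeWhile_sublist _).subset hy

lemma dtl_append (a z : α) (l : List α) (h : z ≠ a) :
    dropToLastOcc a (l ++ [z]) = dropToLastOcc a l ++ [z] := by
  unfold dropToLastOcc
  simp [h]

lemma EE_sub (S : Finset α) (l : List α) : ∀ y ∈ EE S l, y ∈ l := by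
  induction hn : l.length using Nat.strong_induction_on generalizing l with
  | _ n ih =>
    cases l with
    | nil => simp [EE_nil]
    | cons a r =>
      intro y hy
      rw [EE_cons] at hy
      rcases List.mem_cons.1 hy with rfl | hy
      · simp
      · refine List.mem_cons_of_mem _ ?_
        split_ifs at hy with ha
        · refine dtl_sub a r y (ih _ ?_ _ rfl y hy)
          have := dropToLastOcc_length_le a r
          simp at hn; omega
        · refine ih _ ?_ _ rfl y hy
          simp at hn; omega

lemma PLE_append (S : Finset α) (z : α) (l : List α) (hz : z ∉ l) :
    PLE S (l ++ [z]) = EE S l ++ [z] := by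
  induction hn : l.length using Nat.strong_induction_on generalizing l with
  | _ n ih =>
    cases l with
    | nil => rw [List.nil_append, PLE, EE_nil]; simp
    | cons a r =>
      have hza : z ≠ a := by rintro rfl; simp at hz
      have hzr : z ∉ r := by intro h; simp [h] at hz
      rw [List.cons_append, PLE, EE_cons]
      have e1 : (a :: (r ++ [z])).getLast (List.cons_ne_nil _ _) = z := by simp
      rw [e1]
      have hl := dropToLastOcc_length_le a r
      simp at hn
      split_ifs with h1 h2 h3
      · exact absurd h2.symm hza
      · rw [dtl_append _ _ _ hza, ih _ (by omega) _ (fun h => hzr (dtl_sub a r z h)) rfl]; simp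
      · simp at h3
      · rw [ih _ (by omega) _ hzr rfl]; simp

/-- path weight -/
noncomputable def pw (p : α → α → ℝ≥0∞) : (α → ℝ≥0∞) → List α → ℝ≥0∞
  | _, [] => 1
  | f, a :: r => f a * pw p (p a) r

lemma pw_split (p : α → α → ℝ≥0∞) (f : α → ℝ≥0∞) (L : List α) (a : α) (r : List α) :
    pw p f (L ++ a :: r) = pw p f (L ++ [a]) * pw p (p a) r := by
  induction L generalizing f with
  | nil => simp [pw]
  | cons b L ih => simp only [List.cons_append, pw]; rw [ih]; ring

/-- avoidance indicator -/
noncomputable def av (K : Finset α) (l : List α) : ℝ≥0∞ := if ∀ v ∈ l, v ∉ K then 1 else 0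

lemma av_append (K : Finset α) (l m : List α) : av K (l ++ m) = av K l * av K m := by
  unfold av
  by_cases h1 : ∀ v ∈ l, v ∉ K
  · by_cases h2 : ∀ v ∈ m, v ∉ K
    · rw [if_pos, if_pos h1, if_pos h2]; · simp
      intro v hv; rcases List.mem_append.1 hv with h | h
      · exact h1 v h
      · exact h2 v h
    · rw [if_neg, if_neg h2]; · simp
      intro h; exact h2 fun v hv => h v (List.mem_append_right _ hv)
  · rw [if_neg, if_neg h1]; · simp
    intro h; exact h1 fun v hv => h v (List.mem_append_left _ hv)

lemma av_cons (K : Finset α) (a : α) (m : List α) (h : a ∉ K) : av K (a :: m) = av K m := by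
  unfold av; simp [h]

lemma av_cons_mem (K : Finset α) (a : α) (m : List α) (h : a ∈ K) : av K (a :: m) = 0 := by
  unfold av; simp [h]

lemma av_insert (K : Finset α) (a : α) (l : List α) :
    av (insert a K) l = if a ∈ l then 0 else av K l := by
  unfold av
  by_cases h : a ∈ l
  · rw [if_pos h, if_neg]; intro h'; exact h' a h (by simp)
  · rw [if_neg h]
    congr 1
    apply propext
    refine forall₂_congr fun v hv => ?_
    have : v ≠ a := by rintro rfl; exact h hv
    simp [this]

/-- positive length path sum with interior avoiding `K` -/
noncomputable def SS (p : α → α → ℝ≥0∞) (K : Finset α) (a b : α) : ℝ≥0∞ :=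
  ∑' N : List α, av K N * pw p (p a) (N ++ [b])

/-- Green's function -/
noncomputable def GG (p : α → α → ℝ≥0∞) (K : Finset α) (a : α) : ℝ≥0∞ := 1 + SS p K a a

lemma SS_first (p : α → α → ℝ≥0∞) (K : Finset α) (a b c : α) (hc : c ∉ K) :
    SS p K a b = SS p (insert c K) a b + SS p (insert c K) a c * SS p K c b := by
  unfold SS
  rw [tsum_first c]
  congr 1
  · refine tsum_congr fun r => ?_
    rw [av_insert]; split_ifs <;> simp
  · rw [← ENNReal.tsum_mul_right]
    refine tsum_congr fun N => ?_
    rw [← ENNReal.tsum_mul_left]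
    refine tsum_congr fun r => ?_
    rw [av_insert, av_append, av_cons _ _ _ hc, List.append_assoc, List.cons_append, pw_split]
    split_ifs
    · simp
    · ring

lemma SS_last (p : α → α → ℝ≥0∞) (K : Finset α) (a b c : α) (hc : c ∉ K) :
    SS p K a b = SS p (insert c K) a b + SS p K a c * SS p (insert c K) c b := by
  unfold SS
  rw [tsum_last c]
  congr 1
  · refine tsum_congr fun r => ?_
    rw [av_insert]; split_ifs <;> simp
  · rw [← ENNReal.tsum_mul_right]
    refine tsum_congr fun N => ?_
    rw [← ENNReal.tsum_mul_left]
    refine tsum_congr fun r => ?_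
    rw [av_insert, av_append, av_cons _ _ _ hc, List.append_assoc, List.cons_append, pw_split]
    split_ifs
    · simp
    · ring

lemma GG_rec (p : α → α → ℝ≥0∞) (K : Finset α) (a b : α) (hab : a ≠ b) (ha : a ∉ K) (hb : b ∉ K) :
    GG p K a = GG p (insert b K) a + GG p (insert b K) a *
      (SS p (insert a (insert b K)) a b * SS p (insert a (insert b K)) b a) *
        GG p K b * GG p (insert b K) a := by
  have ha' : a ∉ insert b K := by simp [hab, ha]
  have h1 := SS_first p K a a b hb
  have h2 := SS_last p K b a b hb
  have h3 := SS_last p (insert b K) a b a ha'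
  have h4 := SS_first p (insert b K) b a a ha'
  unfold GG
  rw [h1, h2, h3, h4]
  ring

lemma GG_symm (p : α → α → ℝ≥0∞) (K : Finset α) (a b : α) (hab : a ≠ b)
    (ha : a ∉ K) (hb : b ∉ K) :
    GG p K a * GG p (insert a K) b = GG p K b * GG p (insert b K) a := by
  have h1 := GG_rec p K a b hab ha hb
  have h2 := GG_rec p K b a hab.symm hb ha
  rw [Finset.insert_comm b a K] at h2
  set s := GG p K a * GG p (insert a K) b with hs
  set t := GG p K b * GG p (insert b K) a with ht
  set c := GG p (insert a K) b * GG p (insert b K) a with hc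
  set X := SS p (insert a (insert b K)) a b * SS p (insert a (insert b K)) b a with hX
  have e1 : s = c + c * X * t := by rw [hs, h1, hc, ht]; ring
  have e2 : t = c + c * X * s := by
    rw [ht, h2, hc, hs, hX]; ring
  rcases le_total s t with h | h
  · refine le_antisymm h ?_
    calc t = c + c * X * s := e2
      _ ≤ c + c * X * t := by gcongr
      _ = s := e1.symm
  · refine le_antisymm ?_ h
    calc s = c + c * X * t := e1
      _ ≤ c + c * X * s := by gcongr
      _ = t := e2.symm

/-- the extra factor in the law of the partially erased path -/
noncomputable def gam (p : α → α → ℝ≥0∞) (S : Finset α) : Finset α → List α → ℝ≥0∞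
  | _, [] => 1
  | K, a :: r => if a ∈ K then 0 else if a ∈ S then GG p K a * gam p S (insert a K) r
      else gam p S K r

lemma gam_zero (p : α → α → ℝ≥0∞) (S K : Finset α) (l : List α) (a : α) (ha : a ∈ K)
    (h : a ∈ l) : gam p S K l = 0 := by
  induction l generalizing K with
  | nil => simp at h
  | cons b r ih =>
    unfold gam
    rcases List.mem_cons.1 h with rfl | h
    · simp [ha]
    · rw [ih K ha h, ih (insert b K) (by simp [ha]) h]; simp

lemma gam_perm (p : α → α → ℝ≥0∞) (S K : Finset α) (l m : List α) (h : l.Perm m) :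
    gam p S K l = gam p S K m := by
  induction h generalizing K with
  | nil => rfl
  | cons a _ ih => simp only [gam, ih]
  | swap a b l =>
    by_cases hab : a = b
    · subst hab; rfl
    · have hba : b ≠ a := fun h => hab h.symm
      simp only [gam, Finset.mem_insert, hab, hba, false_or]
      by_cases h1 : a ∈ K <;> by_cases h2 : b ∈ K <;> by_cases h3 : a ∈ S <;>
        by_cases h4 : b ∈ S <;> simp [h1, h2, h3, h4]
      rw [← mul_assoc, ← mul_assoc, GG_symm p K a b hab h1 h2, Finset.insert_comm]
  | trans _ _ ih1 ih2 => rw [ih1, ih2]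

/-- `S`-vertices of a list -/
def sv (S : Finset α) (l : List α) : Finset α := l.toFinset ∩ S

lemma gam_append (p : α → α → ℝ≥0∞) (S K : Finset α) (l m : List α) :
    gam p S K (l ++ m) = gam p S K l * gam p S (K ∪ sv S l) m := by
  induction l generalizing K with
  | nil => simp [gam, sv]
  | cons a r ih =>
    simp only [List.cons_append, gam]
    split_ifs with h1 h2
    · simp
    · rw [ih, mul_assoc]
      congr 3
      ext v; simp [sv]; grind
    · rw [ih]
      congr 2
      ext v; simp [sv]; grind

lemma gam_green (p : α → α → ℝ≥0∞) (S K : Finset α) (l : List α) (a : α) (haS : a ∉ S)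
    (haK : a ∉ K) (hal : a ∉ l) :
    gam p S K l * GG p (K ∪ sv S l) a = GG p K a * gam p S (insert a K) l := by
  induction l generalizing K with
  | nil => simp [gam, sv]
  | cons b r ih =>
    have hab : a ≠ b := by rintro rfl; simp at hal
    have har : a ∉ r := by intro h; simp [h] at hal
    have hba : b ≠ a := fun h => hab h.symm
    simp only [gam, Finset.mem_insert, hba, false_or]
    split_ifs with h1 h2
    · simp
    · have e : K ∪ sv S (b :: r) = insert b K ∪ sv S r := by
        ext v; simp [sv]; grind
      rw [e, mul_assoc, ih (insert b K) (by simp [hab, haK]) har, ← mul_assoc,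
        GG_symm p K b a hba h1 haK, Finset.insert_comm, mul_assoc]
    · have e : K ∪ sv S (b :: r) = K ∪ sv S r := by
        ext v; simp [sv]; grind
      rw [e, ih K haK har]

lemma law1 (p : α → α → ℝ≥0∞) (S K : Finset α) (z : α) (u : List α) (f : α → ℝ≥0∞) :
    ∑' l, (if EE S l = u then av K l * pw p f (l ++ [z]) else 0) =
      pw p f (u ++ [z]) * gam p S K u := by
  induction u generalizing K f with
  | nil =>
    rw [tsum_eq_single []]
    · simp [EE_nil, gam, av]
    · intro l hl; simp [EE_eq_nil, hl]
  | cons a u ih =>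
    rw [tsum_cons a]
    swap
    · intro l hl
      cases l with
      | nil => simp [EE_nil] at hl
      | cons b r =>
        rw [EE_cons] at hl
        refine ⟨r, ?_⟩
        by_contra hne
        apply hl
        rw [if_neg]
        intro h
        simp at h hne
        exact hne h.1
    simp only [EE_cons, List.cons.injEq, true_and]
    by_cases haK : a ∈ K
    · simp [gam, haK, av_cons_mem]
    simp only [av_cons _ _ _ haK, List.cons_append, pw, gam, haK, if_false]
    by_cases haS : a ∈ S
    · simp only [haS, if_true]
      rw [tsum_last a]
      have e1 : ∀ r, (if a ∈ r then 0 else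
          if EE S (dropToLastOcc a r) = u then av K r * (f a * pw p (p a) (r ++ [z])) else 0) =
          f a * (if EE S r = u then av (insert a K) r * pw p (p a) (r ++ [z]) else 0) := by
        intro r
        rw [av_insert]
        by_cases h : a ∈ r
        · simp [h]
        · simp only [h, if_false, dtl_notin _ _ h]; split_ifs
          · ring
          · simp
      have e2 : ∀ N r, (if a ∈ r then 0 else
          if EE S (dropToLastOcc a (N ++ a :: r)) = u then av K (N ++ a :: r) *
            (f a * pw p (p a) (N ++ a :: r ++ [z])) else 0) =
          f a * (av K N * pw p (p a) (N ++ [a])) *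
            (if EE S r = u then av (insert a K) r * pw p (p a) (r ++ [z]) else 0) := by
        intro N r
        rw [av_insert]
        by_cases h : a ∈ r
        · simp [h]
        · simp only [h, if_false, dtl_split _ _ _ h]; split_ifs
          · rw [av_append, av_cons _ _ _ haK, List.append_assoc, List.cons_append, pw_split]
            ring
          · simp
      simp only [e1, e2, ENNReal.tsum_mul_left, ENNReal.tsum_mul_right, ih]
      unfold GG SS
      ring
    · simp only [haS, if_false]
      rw [mul_assoc, ← ih, ← ENNReal.tsum_mul_left]
      refine tsum_congr fun r => ?_
      split_ifs
      · ring
      · simp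

lemma fib (E : List α → List α) (c : List α → ℝ≥0∞) (H : List α → ℝ≥0∞) :
    ∑' l, c l * H (E l) = ∑' u, (∑' l, if E l = u then c l else 0) * H u := by
  simp only [← ENNReal.tsum_mul_right]
  rw [ENNReal.tsum_comm]
  refine tsum_congr fun l => ?_
  rw [tsum_eq_single (E l)]
  · simp
  · intro u hu
    rw [if_neg (fun h => hu h.symm), zero_mul]

lemma loopsum (p : α → α → ℝ≥0∞) (S K : Finset α) (a b : α) :
    ∑' N, pw p (p a) (N ++ [b]) * gam p S K N = SS p K a b := by
  have h := fib (EE S) (fun l => av K l * pw p (p a) (l ++ [b])) (fun _ => 1)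
  simp only [mul_one, law1] at h
  exact h.symm

lemma law2 (p : α → α → ℝ≥0∞) (S T K : Finset α) (hST : S ⊆ T) (z : α) (u : List α)
    (f : α → ℝ≥0∞) :
    ∑' l, (if EE T l = u then pw p f (l ++ [z]) * gam p S K l else 0) =
      pw p f (u ++ [z]) * gam p T K u := by
  induction u generalizing K f with
  | nil =>
    rw [tsum_eq_single []]
    · simp [EE_nil, gam]
    · intro l hl; simp [EE_eq_nil, hl]
  | cons a u ih =>
    rw [tsum_cons a]
    swap
    · intro l hl
      cases l with
      | nil => simp [EE_nil] at hl
      | cons b r =>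
        rw [EE_cons] at hl
        refine ⟨r, ?_⟩
        by_contra hne
        apply hl
        rw [if_neg]
        intro h
        simp at h hne
        exact hne h.1
    simp only [EE_cons, List.cons.injEq, true_and]
    by_cases haK : a ∈ K
    · simp [gam, haK]
    simp only [List.cons_append, pw, gam, haK, if_false]
    by_cases haS : a ∈ S
    · have haT := hST haS
      simp only [haS, haT, if_true]
      have e1 : ∀ r, (if EE T (dropToLastOcc a r) = u then
          f a * pw p (p a) (r ++ [z]) * (GG p K a * gam p S (insert a K) r) else 0) =
          f a * GG p K a * (if EE T r = u then pw p (p a) (r ++ [z]) * gam p S (insert a K) r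
            else 0) := by
        intro r
        by_cases h : a ∈ r
        · simp [gam_zero p S (insert a K) r a (by simp) h]
        · rw [dtl_notin _ _ h]; split_ifs
          · ring
          · simp
      simp only [e1, ENNReal.tsum_mul_left, ih]
      ring
    · by_cases haT : a ∈ T
      · simp only [haS, haT, if_true, if_false]
        rw [tsum_last a, ENNReal.tsum_comm, ← ENNReal.tsum_add]
        have e : ∀ r, ((if a ∈ r then 0 else
            if EE T (dropToLastOcc a r) = u then f a * pw p (p a) (r ++ [z]) * gam p S K r
              else 0) +
            ∑' N, (if a ∈ r then 0 else
              if EE T (dropToLastOcc a (N ++ a :: r)) = u then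
                f a * pw p (p a) (N ++ a :: r ++ [z]) * gam p S K (N ++ a :: r) else 0)) =
            f a * GG p K a * (if EE T r = u then pw p (p a) (r ++ [z]) * gam p S (insert a K) r
              else 0) := by
          intro r
          by_cases h : a ∈ r
          · simp [h, gam_zero p S (insert a K) r a (by simp) h]
          · simp only [h, if_false, dtl_split _ _ _ h, dtl_notin _ _ h]
            split_ifs
            · have e2 : ∀ N, f a * pw p (p a) (N ++ a :: r ++ [z]) * gam p S K (N ++ a :: r) =
                  f a * pw p (p a) (r ++ [z]) * gam p S K r *
                    (pw p (p a) (N ++ [a]) * gam p S (K ∪ sv S r) N) := by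
                intro N
                have hp : (N ++ a :: r).Perm (a :: (r ++ N)) := by
                  refine List.perm_middle.trans ?_
                  exact List.Perm.cons _ List.perm_append_comm
                rw [gam_perm p S K _ _ hp, List.append_assoc, List.cons_append, pw_split]
                rw [gam, if_neg haK, if_neg haS, gam_append]
                ring
              simp only [e2, ENNReal.tsum_mul_left, loopsum]
              have := gam_green p S K r a haS haK h
              calc _ = f a * pw p (p a) (r ++ [z]) * (gam p S K r * GG p (K ∪ sv S r) a) := by
                    unfold GG; ring
                _ = _ := by rw [this]; ring
            · simp
        simp only [e, ENNReal.tsum_mul_left, ih]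
        ring
      · simp only [haS, haT, if_false]
        rw [mul_assoc, ← ih, ← ENNReal.tsum_mul_left]
        refine tsum_congr fun r => ?_
        split_ifs
        · ring
        · simp

/-- iterated simplified erasure -/
def iterEE (W : ℕ → Finset α) : ℕ → List α → List α
  | 0, l => l
  | n + 1, l => EE (W (n + 1)) (iterEE W n l)

lemma iterEE_sub (W : ℕ → Finset α) (n : ℕ) (l : List α) : ∀ y ∈ iterEE W n l, y ∈ l := by
  induction n with
  | zero => intro y hy; exact hy
  | succ n ih => intro y hy; exact ih y (EE_sub _ _ y hy)

lemma iterPLE_append [Fintype α] (W : ℕ → Finset α) (n : ℕ) (z : α) (l : List α) (hz : z ∉ l) :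
    iterPLE W n (l ++ [z]) = iterEE W n l ++ [z] := by
  induction n with
  | zero => rfl
  | succ n ih =>
    simp only [iterPLE, iterEE, ih]
    exact PLE_append _ _ _ fun h => hz (iterEE_sub W n l z h)

lemma law_iter (p : α → α → ℝ≥0∞) (W : ℕ → Finset α) (m : ℕ)
    (hW : ∀ j : ℕ, 1 ≤ j → j < m → W j ⊆ W (j + 1)) (K : Finset α) (z : α) (f : α → ℝ≥0∞)
    (n : ℕ) (hn : n + 1 ≤ m) (H : List α → ℝ≥0∞) :
    ∑' l, av K l * pw p f (l ++ [z]) * H (iterEE W (n + 1) l) =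
      ∑' u, pw p f (u ++ [z]) * gam p (W (n + 1)) K u * H u := by
  induction n generalizing H with
  | zero =>
    simp only [iterEE]
    rw [fib (EE (W (0 + 1))) (fun l => av K l * pw p f (l ++ [z])) H]
    simp only [law1]
  | succ n ih =>
    have h := ih (by omega) (fun l => H (EE (W (n + 1 + 1)) l))
    rw [show (∑' l, av K l * pw p f (l ++ [z]) * H (iterEE W (n + 1 + 1) l)) =
      ∑' l, av K l * pw p f (l ++ [z]) * H (EE (W (n + 1 + 1)) (iterEE W (n + 1) l)) from rfl, h,
      fib (EE (W (n + 1 + 1))) (fun u => pw p f (u ++ [z]) * gam p (W (n + 1)) K u) H]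
    simp only [law2 p _ _ K (hW (n + 1) (by omega) (by omega))]

lemma law_main [Fintype α] (p : α → α → ℝ≥0∞) (W : ℕ → Finset α) (m : ℕ) (hm : 1 ≤ m)
    (hW : ∀ j : ℕ, 1 ≤ j → j < m → W j ⊆ W (j + 1)) (hWm : W m = Finset.univ)
    (K : Finset α) (z : α) (f : α → ℝ≥0∞) (H : List α → ℝ≥0∞) :
    ∑' l, av K l * pw p f (l ++ [z]) * H (EE Finset.univ l) =
      ∑' l, av K l * pw p f (l ++ [z]) * H (iterEE W m l) := by
  obtain ⟨n, rfl⟩ : ∃ n, m = n + 1 := ⟨m - 1, by omega⟩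
  rw [law_iter p W (n + 1) hW K z f n le_rfl H, hWm,
    fib (EE Finset.univ) (fun l => av K l * pw p f (l ++ [z])) H]
  simp only [law1]


lemma pw_range (p : α → α → ℝ≥0∞) (f : α → ℝ≥0∞) (y : ℕ → α) (n : ℕ) :
    pw p f ((List.range (n + 1)).map y) =
      f (y 0) * ∏ i ∈ Finset.Icc 1 n, p (y (i - 1)) (y i) := by
  induction n with
  | zero => simp [pw]
  | succ n ih =>
    rw [Finset.prod_Icc_succ_top (by omega), ← mul_assoc, ← ih, List.range_succ, List.map_append,
      List.range_succ, List.map_append]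
    simp only [List.map_cons, List.map_nil, List.append_assoc, List.singleton_append]
    rw [pw_split]
    simp [pw]

lemma stop_eq [Fintype α] (A : Finset α) (ω : ℕ → α) :
    stoppedPath A ω = (List.range (entryTimeNat A ω)).map ω ++ [ω (entryTimeNat A ω)] := by
  unfold stoppedPath
  rw [List.range_succ, List.map_append]; rfl

lemma entry_mem [Fintype α] (A : Finset α) (ω : ℕ → α) (h : ∃ n, ω n ∈ A) :
    ω (entryTimeNat A ω) ∈ A := Nat.sInf_mem (s := {n | ω n ∈ A}) h

lemma entry_lt [Fintype α] (A : Finset α) (ω : ℕ → α) (n : ℕ) (h : n < entryTimeNat A ω) :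
    ω n ∉ A := Nat.notMem_of_lt_sInf (s := {n | ω n ∈ A}) h

lemma entry_unique [Fintype α] (A : Finset α) (ω : ℕ → α) (n : ℕ) (h : ω n ∈ A)
    (h' : ∀ i < n, ω i ∉ A) : entryTimeNat A ω = n := by
  refine le_antisymm (Nat.sInf_le h) ?_
  by_contra hlt
  exact h' _ (not_le.1 hlt) (entry_mem A ω ⟨n, h⟩)

lemma map_getD (l : List α) (z : α) :
    (List.range (l.length + 1)).map (fun i => (l ++ [z]).getD i z) = l ++ [z] := by
  apply List.ext_getElem
  · simp
  · intro i h1 h2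
    simp only [List.getElem_map, List.getElem_range]
    rw [List.getD_eq_getElem _ _ h2]

lemma stop_fiber [Fintype α] (A : Finset α) (l : List α) (z : α) (hz : z ∈ A)
    (hl : ∀ v ∈ l, v ∉ A) :
    {ω : ℕ → α | (∃ n, ω n ∈ A) ∧ stoppedPath A ω = l ++ [z]} =
      {ω | ∀ i ≤ l.length, ω i = (l ++ [z]).getD i z} := by
  ext ω
  simp only [Set.mem_setOf_eq]
  constructor
  · rintro ⟨h, hs⟩ i hi
    have hlen := congrArg List.length hs
    simp only [stoppedPath, List.length_map, List.length_range, List.length_append,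
      List.length_singleton] at hlen
    rw [← hs]
    unfold stoppedPath
    rw [List.getD_eq_getElem _ _ (by simp; omega)]
    simp
  · intro h
    have hn : ω l.length = z := by rw [h _ le_rfl]; simp
    have hlt : ∀ i < l.length, ω i ∉ A := by
      intro i hi
      rw [h i hi.le, List.getD_eq_getElem _ _ (by simp; omega), List.getElem_append_left hi]
      exact hl _ (List.getElem_mem _)
    have hA : ω l.length ∈ A := by rw [hn]; exact hz
    refine ⟨⟨_, hA⟩, ?_⟩
    unfold stoppedPath
    rw [entry_unique A ω _ hA hlt]
    conv_rhs => rw [← map_getD l z]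
    refine List.map_congr_left fun i hi => h i ?_
    have := List.mem_range.1 hi
    omega

lemma stop_fiber_empty [Fintype α] (A : Finset α) (l : List α) (z : α)
    (h : ¬ (z ∈ A ∧ ∀ v ∈ l, v ∉ A)) :
    {ω : ℕ → α | (∃ n, ω n ∈ A) ∧ stoppedPath A ω = l ++ [z]} = ∅ := by
  ext ω
  simp only [Set.mem_setOf_eq, Set.mem_empty_iff_false, iff_false]
  rintro ⟨hit, hs⟩
  apply h
  rw [stop_eq] at hs
  obtain ⟨h1, h2⟩ := List.append_inj' hs rfl
  have h3 : ω (entryTimeNat A ω) = z := by simpa using h2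
  refine ⟨h3 ▸ entry_mem A ω hit, ?_⟩
  intro v hv
  rw [← h1] at hv
  obtain ⟨i, hi, rfl⟩ := List.mem_map.1 hv
  exact entry_lt A ω i (List.mem_range.1 hi)

lemma measure_fiber [Fintype α] [MeasurableSpace α] [MeasurableSingletonClass α]
    (P : α → α → ℝ) (μ : Measure (ℕ → α)) (x : α) (hP0 : ∀ a b, 0 ≤ P a b)
    (hlaw : ∀ (n : ℕ) (y : ℕ → α),
      μ {ω | ∀ i ≤ n, ω i = y i} =
        ENNReal.ofReal ((if x = y 0 then (1 : ℝ) else 0) *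
          ∏ i ∈ Finset.Icc 1 n, P (y (i - 1)) (y i)))
    (A : Finset α) (l : List α) (z : α) :
    μ {ω | (∃ n, ω n ∈ A) ∧ stoppedPath A ω = l ++ [z]} =
      (if z ∈ A then 1 else 0) * (av A l * pw (fun a b => ENNReal.ofReal (P a b))
        (fun a => if x = a then 1 else 0) (l ++ [z])) := by
  by_cases h : z ∈ A ∧ ∀ v ∈ l, v ∉ A
  · rw [stop_fiber A l z h.1 h.2, hlaw, if_pos h.1, av, if_pos h.2, one_mul, one_mul]
    conv_rhs => rw [← map_getD l z]
    rw [pw_range, ENNReal.ofReal_mul (by split_ifs <;> simp),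
      ENNReal.ofReal_prod_of_nonneg (fun i _ => hP0 _ _)]
    congr 1
    split_ifs <;> simp
  · rw [stop_fiber_empty A l z h, measure_empty]
    by_cases hz : z ∈ A
    · rw [av, if_neg (fun h' => h ⟨hz, h'⟩)]; simp
    · simp [hz]

lemma meas_fiber [Fintype α] [MeasurableSpace α] [MeasurableSingletonClass α]
    (A : Finset α) (q : List α) :
    MeasurableSet {ω : ℕ → α | (∃ n, ω n ∈ A) ∧ stoppedPath A ω = q} := by
  rcases List.eq_nil_or_concat q with rfl | ⟨l, z, rfl⟩
  · simp [stop_eq]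
  · rw [List.concat_eq_append]
    by_cases h : z ∈ A ∧ ∀ v ∈ l, v ∉ A
    · rw [stop_fiber A l z h.1 h.2]
      have : {ω : ℕ → α | ∀ i ≤ l.length, ω i = (l ++ [z]).getD i z} =
          ⋂ i, ⋂ (_ : i ≤ l.length), (fun ω : ℕ → α => ω i) ⁻¹' {(l ++ [z]).getD i z} := by
        ext ω; simp
      rw [this]
      exact MeasurableSet.iInter fun i => MeasurableSet.iInter fun _ =>
        measurable_pi_apply i (measurableSet_singleton _)
    · rw [stop_fiber_empty A l z h]; exact MeasurableSet.empty

lemma measure_event [Fintype α] [MeasurableSpace α] [MeasurableSingletonClass α]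
    (P : α → α → ℝ) (μ : Measure (ℕ → α)) (x : α) (hP0 : ∀ a b, 0 ≤ P a b)
    (hlaw : ∀ (n : ℕ) (y : ℕ → α),
      μ {ω | ∀ i ≤ n, ω i = y i} =
        ENNReal.ofReal ((if x = y 0 then (1 : ℝ) else 0) *
          ∏ i ∈ Finset.Icc 1 n, P (y (i - 1)) (y i)))
    (A : Finset α) (Φ : List α → List α) (E : List α → List α) (w : List α)
    (hΦ : ∀ l z, z ∉ l → Φ (l ++ [z]) = E l ++ [z]) :
    μ {ω | (∃ n, ω n ∈ A) ∧ Φ (stoppedPath A ω) = w} =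
      ∑' z, (if z ∈ A then 1 else 0) * ∑' l, av A l * pw (fun a b => ENNReal.ofReal (P a b))
        (fun a => if x = a then 1 else 0) (l ++ [z]) * (if E l ++ [z] = w then 1 else 0) := by
  have e1 : {ω | (∃ n, ω n ∈ A) ∧ Φ (stoppedPath A ω) = w} =
      ⋃ q : ({q | Φ q = w} : Set (List α)), {ω : ℕ → α | (∃ n, ω n ∈ A) ∧ stoppedPath A ω = q} := by
    ext ω
    simp only [Set.mem_setOf_eq, Set.mem_iUnion]
    constructor
    · rintro ⟨h1, h2⟩
      exact ⟨⟨_, h2⟩, h1, rfl⟩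
    · rintro ⟨⟨q, hq⟩, h1, h2⟩
      exact ⟨h1, by rw [h2]; exact hq⟩
  rw [e1, measure_iUnion]
  · rw [tsum_subtype {q | Φ q = w}
      (fun q => μ {ω : ℕ → α | (∃ n, ω n ∈ A) ∧ stoppedPath A ω = q})]
    have hinj : Function.Injective (fun r : α × List α => r.2 ++ [r.1]) := by
      rintro ⟨a, r⟩ ⟨b, s⟩ h
      obtain ⟨h1, h2⟩ := List.append_inj' h rfl
      simp at h1 h2
      simp [h1, h2]
    rw [← hinj.tsum_eq]
    · rw [ENNReal.tsum_prod']
      refine tsum_congr fun z => ?_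
      rw [← ENNReal.tsum_mul_left]
      refine tsum_congr fun l => ?_
      simp only [Set.indicator_apply, Set.mem_setOf_eq]
      rw [measure_fiber P μ x hP0 hlaw]
      by_cases h : z ∈ A ∧ ∀ v ∈ l, v ∉ A
      · have hzl : z ∉ l := fun hh => h.2 z hh h.1
        rw [hΦ l z hzl]
        split_ifs <;> simp
      · by_cases hz : z ∈ A
        · rw [av, if_neg (fun h' => h ⟨hz, h'⟩)]; simp
        · simp [hz]
    · intro q hq
      rcases List.eq_nil_or_concat q with rfl | ⟨l, z, rfl⟩
      · exfalso; apply hq; simp [stop_eq]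
      · exact ⟨(z, l), by simp⟩
  · intro q q' hqq
    refine Set.disjoint_left.2 ?_
    rintro ω ⟨_, h1⟩ ⟨_, h2⟩
    exact hqq (Subtype.ext (h1.symm.trans h2))
  · intro q
    exact meas_fiber A q

end Aux

theorem loop_erasure_eq_refinement_of_partial_loop_erasures
    {V : Type*} [Fintype V] [DecidableEq V] [Nonempty V]
    [MeasurableSpace V] [MeasurableSingletonClass V]
    (P : V → V → ℝ) (μ : V → Measure (ℕ → V))
    (hP0 : ∀ a b : V, 0 ≤ P a b) (hP1 : ∀ a : V, ∑ b : V, P a b = 1)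
    (hprob : ∀ a : V, IsProbabilityMeasure (μ a))
    (hlaw : ∀ (a : V) (n : ℕ) (y : ℕ → V),
      μ a {ω | ∀ i ≤ n, ω i = y i} =
        ENNReal.ofReal ((if a = y 0 then (1 : ℝ) else 0) *
          ∏ i ∈ Finset.Icc 1 n, P (y (i - 1)) (y i)))
    (m : ℕ) (hm : 1 ≤ m) (W : ℕ → Finset V)
    (hW1 : (W 1).Nonempty)
    (hWmono : ∀ j : ℕ, 1 ≤ j → j < m → W j ⊆ W (j + 1))
    (hWm : W m = Finset.univ)
    (A : Finset V) (x : V)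
    (hx : μ x {ω | ∃ n : ℕ, ω n ∈ A} = 1) :
    ∀ w : List V,
      μ x {ω | (∃ n : ℕ, ω n ∈ A) ∧ LE (stoppedPath A ω) = w} =
        μ x {ω | (∃ n : ℕ, ω n ∈ A) ∧ iterPLE W m (stoppedPath A ω) = w} := by
  intro w
  rw [measure_event P (μ x) x hP0 (hlaw x) A LE (EE Finset.univ) w
      (fun l z hz => PLE_append _ z l hz),
    measure_event P (μ x) x hP0 (hlaw x) A (iterPLE W m) (iterEE W m) w
      (fun l z hz => iterPLE_append W m z l hz)]
  refine tsum_congr fun z => ?_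
  congr 1
  exact law_main _ W m hm hWmono hWm A z _ (fun u => if u ++ [z] = w then 1 else 0)

end LERW
end

section
/- Let (Ω, X_n, ℙ_x) be a Markov chain on a finite set V with at least two elements, let b ∈ V and set V_1 = V ∖ {b}. Then for any A ⊆ V and x ∈ V with ℙ_x(τ_A < ∞) = 1 and every finite path w on V, ℙ_x(𝔏(X|_{[0,τ_A]}) = w) = ℙ_x(𝔏 ∘ 𝔏_{V∖{b}}(X|_{[0,τ_A]}) = w). -/
open MeasureTheory

namespace LERW

variable {V : Type*} [DecidableEq V]

variable [Fintype V]

variable [MeasurableSpace V]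

section Helpers

variable {V : Type*} [DecidableEq V]

lemma drop_nil (a : V) : dropToLastOcc a [] = [] := by simp [dropToLastOcc]

lemma drop_snoc_self (a : V) (l : List V) : dropToLastOcc a (l ++ [a]) = [] := by
  simp [dropToLastOcc]

lemma drop_snoc_ne (a c : V) (h : c ≠ a) (l : List V) :
    dropToLastOcc a (l ++ [c]) = dropToLastOcc a l ++ [c] := by
  simp [dropToLastOcc, h]

lemma drop_not_mem (a : V) (l : List V) : a ∉ dropToLastOcc a l := by
  induction l using List.reverseRecOn with
  | nil => simp [drop_nil]
  | append_singleton l c ih =>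
    by_cases h : c = a
    · subst h; simp [drop_snoc_self]
    · rw [drop_snoc_ne a c h]; simp [ih, Ne.symm h]

lemma drop_of_not_mem (a : V) (l : List V) (h : a ∉ l) : dropToLastOcc a l = l := by
  induction l using List.reverseRecOn with
  | nil => simp [drop_nil]
  | append_singleton l c ih =>
    simp at h
    rw [drop_snoc_ne a c (Ne.symm h.2), ih h.1]

lemma drop_cons_of_mem (a c : V) (l : List V) (h : a ∈ l) :
    dropToLastOcc a (c :: l) = dropToLastOcc a l := by
  induction l using List.reverseRecOn with
  | nil => simp at h
  | append_singleton l d ih =>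
    rw [← List.cons_append]
    by_cases hd : d = a
    · subst hd; simp only [drop_snoc_self]
    · rw [drop_snoc_ne a d hd, drop_snoc_ne a d hd, ih]
      simp at h
      exact h.resolve_right (Ne.symm hd)

lemma drop_cons_self (a : V) (l : List V) :
    dropToLastOcc a (a :: l) = dropToLastOcc a l := by
  by_cases h : a ∈ l
  · exact drop_cons_of_mem a a l h
  · rw [drop_of_not_mem a l h]
    induction l using List.reverseRecOn with
    | nil => simpa [drop_nil] using drop_snoc_self a []
    | append_singleton l d ih =>
      simp at h
      rw [← List.cons_append, drop_snoc_ne a d (Ne.symm h.2), ih h.1]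

lemma drop_subset (a : V) (l : List V) : dropToLastOcc a l ⊆ l := by
  intro c hc
  unfold dropToLastOcc at hc
  rw [List.mem_reverse] at hc
  exact List.mem_reverse.1 ((List.takeWhile_sublist _).subset hc)

lemma PLE_nil (S : Finset V) : PLE S [] = [] := by rw [PLE]

lemma drop_getLast_self (a : V) (l : List V) (h : a = (a :: l).getLast (List.cons_ne_nil a l)) :
    dropToLastOcc a l = [] := by
  induction l using List.reverseRecOn with
  | nil => simp [drop_nil]
  | append_singleton l d ih =>
    rw [List.getLast_cons (by simp)] at h
    simp at h
    subst h; exact drop_snoc_self _ _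

lemma PLE_cons (S : Finset V) (a : V) (l : List V) :
    PLE S (a :: l) = a :: PLE S (if a ∈ S then dropToLastOcc a l else l) := by
  rw [PLE]
  split_ifs with h1 h2 h3
  · rw [drop_getLast_self a l h2, PLE_nil]
  · rfl
  · rw [h3, PLE_nil]
  · rfl

lemma PLE_subset (S : Finset V) (l : List V) : PLE S l ⊆ l := by
  induction hn : l.length using Nat.strong_induction_on generalizing l with
  | _ n ih =>
    cases l with
    | nil => simp [PLE_nil]
    | cons a l =>
      rw [PLE_cons]
      simp at hn
      refine List.cons_subset_cons a ?_
      split_ifs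
      · exact List.Subset.trans (ih _ (by have := dropToLastOcc_length_le a l; omega)
          (dropToLastOcc a l) rfl) (drop_subset a l)
      · exact ih _ (by omega) _ rfl

lemma drop_getLast? (a : V) (l : List V) :
    (dropToLastOcc a l).getLast? = if l.getLast? = some a then none else l.getLast? := by
  induction l using List.reverseRecOn with
  | nil => simp [drop_nil]
  | append_singleton l d ih =>
    by_cases h : d = a
    · subst h; simp [drop_snoc_self]
    · rw [drop_snoc_ne a d h]; simp [h]

lemma PLE_getLast? (S : Finset V) (l : List V) : (PLE S l).getLast? = l.getLast? := by
  induction hn : l.length using Nat.strong_induction_on generalizing l with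
  | _ n ih =>
    cases l with
    | nil => simp [PLE_nil]
    | cons a l =>
      rw [PLE_cons]
      simp at hn
      rw [List.getLast?_cons, List.getLast?_cons]
      split_ifs
      · rw [ih _ (by have := dropToLastOcc_length_le a l; omega) _ rfl, drop_getLast?]
        split_ifs with h
        · simp [h]
        · rfl
      · rw [ih _ (by omega) _ rfl]

lemma PLE_length (S : Finset V) (l : List V) : (PLE S l).length ≤ l.length := by
  induction hn : l.length using Nat.strong_induction_on generalizing l with
  | _ n ih =>
    cases l with
    | nil => simp [PLE_nil]
    | cons a l =>
      rw [PLE_cons]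
      simp at hn
      rw [List.length_cons]
      split_ifs
      · have := dropToLastOcc_length_le a l
        have := ih _ (by omega) (dropToLastOcc a l) rfl
        omega
      · have := ih _ (by omega) l rfl
        omega

variable [Fintype V]

lemma LE_nil : LE ([] : List V) = [] := PLE_nil _

lemma LE_cons (a : V) (l : List V) : LE (a :: l) = a :: LE (dropToLastOcc a l) := by
  unfold LE; rw [PLE_cons]; simp

lemma LE_nodup (l : List V) : (LE l).Nodup := by
  induction hn : l.length using Nat.strong_induction_on generalizing l with
  | _ n ih =>
    cases l with
    | nil => simp [LE_nil]
    | cons a l =>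
      rw [LE_cons]
      simp at hn
      refine List.nodup_cons.2 ⟨fun h => drop_not_mem a l (PLE_subset _ _ h), ?_⟩
      exact ih _ (by have := dropToLastOcc_length_le a l; omega) _ rfl

/-- Backward loop erasure. -/
def BLE (l : List V) : List V := (LE l.reverse).reverse

/-- One backward step. -/
def bstep (a : V) (l : List V) : List V := a :: dropToLastOcc a l

lemma LE_snoc (l : List V) (a : V) :
    LE (l ++ [a]) = (bstep a (LE l).reverse).reverse := by
  induction hn : l.length using Nat.strong_induction_on generalizing l with
  | _ n ih =>
    cases l with
    | nil => simp [LE_nil, bstep, drop_nil, LE_cons]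
    | cons c l =>
      rw [List.cons_append, LE_cons, LE_cons]
      simp at hn
      by_cases h : a = c
      · subst h
        simp [drop_snoc_self, LE_nil, bstep]
      · rw [drop_snoc_ne c a h, ih _ (by have := dropToLastOcc_length_le c l; omega) _ rfl]
        simp [bstep, drop_snoc_ne a c (Ne.symm h)]

lemma BLE_cons (a : V) (l : List V) : BLE (a :: l) = bstep a (BLE l) := by
  unfold BLE
  rw [List.reverse_cons, LE_snoc, List.reverse_reverse]

lemma LE_mem_of_ok (b : V) (m : List V) (hm : ∀ a ≠ b, m.count a ≤ 1) : b ∈ LE m ↔ b ∈ m := by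
  induction m with
  | nil => simp [LE_nil]
  | cons c r ih =>
    rw [LE_cons]
    by_cases hc : c = b
    · simp [hc]
    · have h1 : c ∉ r := by
        have := hm c hc
        simpa [List.count_eq_zero] using this
      rw [drop_of_not_mem c r h1]
      simp only [List.mem_cons]
      rw [ih]
      intro a ha
      exact (List.count_le_count_cons).trans (hm a ha)

lemma LE_drop_of_ok (b : V) (m : List V) (hm : ∀ a ≠ b, m.count a ≤ 1) :
    LE (dropToLastOcc b m) = dropToLastOcc b (LE m) := by
  induction m with
  | nil => simp [LE_nil, drop_nil]
  | cons c r ih =>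
    have hr : ∀ a ≠ b, r.count a ≤ 1 := fun a ha =>
      (List.count_le_count_cons).trans (hm a ha)
    rw [LE_cons]
    by_cases hc : c = b
    · subst hc
      rw [drop_cons_self, drop_cons_self, drop_of_not_mem c (LE _)]
      exact fun h => drop_not_mem c r (PLE_subset _ _ h)
    · have h1 : c ∉ r := by
        have := hm c hc
        simpa [List.count_eq_zero] using this
      rw [drop_of_not_mem c r h1]
      by_cases hb : b ∈ r
      · rw [drop_cons_of_mem _ _ _ hb, drop_cons_of_mem _ _ _ ((LE_mem_of_ok b r hr).2 hb), ih hr]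
      · rw [drop_of_not_mem, drop_of_not_mem, LE_cons, drop_of_not_mem c r h1]
        · simp [Ne.symm hc, LE_mem_of_ok b r hr, hb]
        · simp [Ne.symm hc, hb]

lemma PLE_ok (b : V) (l : List V) : ∀ a ≠ b, (PLE (Finset.univ \ {b}) l).count a ≤ 1 := by
  induction hn : l.length using Nat.strong_induction_on generalizing l with
  | _ n ih =>
    cases l with
    | nil => simp [PLE_nil]
    | cons c l =>
      rw [PLE_cons]
      simp at hn
      intro a ha
      by_cases hc : c = b
      · have := ih _ (by omega) l rfl a ha
        simpa [hc, List.count_cons_of_ne (Ne.symm ha)] using this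
      · simp only [Finset.mem_sdiff, Finset.mem_univ, Finset.mem_singleton, hc, not_false_eq_true,
          and_self, if_true]
        by_cases hac : a = c
        · subst hac
          rw [List.count_cons_self, List.count_eq_zero_of_not_mem]
          exact fun h => drop_not_mem a l (PLE_subset _ _ h)
        · rw [List.count_cons_of_ne (Ne.symm hac)]
          exact ih _ (by have := dropToLastOcc_length_le c l; omega) _ rfl a ha

/-- The composition. -/
def QLE (b : V) (l : List V) : List V := LE (PLE (Finset.univ \ {b}) l)

lemma QLE_cons_self (b : V) (l : List V) : QLE b (b :: l) = bstep b (QLE b l) := by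
  unfold QLE bstep
  rw [PLE_cons, LE_cons, ← LE_drop_of_ok b _ (PLE_ok b l)]
  simp

lemma QLE_cons_ne (b c : V) (h : c ≠ b) (l : List V) :
    QLE b (c :: l) = c :: QLE b (dropToLastOcc c l) := by
  unfold QLE
  rw [PLE_cons, LE_cons]
  simp only [Finset.mem_sdiff, Finset.mem_univ, Finset.mem_singleton, h, not_false_eq_true,
          and_self, if_true]
  rw [drop_of_not_mem c (PLE _ _)]
  exact fun h => drop_not_mem c l (PLE_subset _ _ h)

/-- Weighted sum of `φ` over `n`-step walks in `D` started at `y`. -/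
def W (P : V → V → ℝ) (D : Finset V) : ℕ → V → (List V → ℝ) → ℝ
  | 0, y, φ => if y ∈ D then φ [y] else 0
  | n + 1, y, φ => if y ∈ D then ∑ z, P y z * W P D n z (fun l => φ (y :: l)) else 0

lemma W_congr (P : V → V → ℝ) (D : Finset V) (n : ℕ) (y : V) (φ ψ : List V → ℝ)
    (h : ∀ t : List V, t.length = n → φ (y :: t) = ψ (y :: t)) :
    W P D n y φ = W P D n y ψ := by
  induction n generalizing y φ ψ with
  | zero => simp [W, h [] rfl]
  | succ n ih =>
    simp only [W]
    split_ifs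
    · refine Finset.sum_congr rfl fun z _ => ?_
      rw [ih z (fun l => φ (y :: l)) (fun l => ψ (y :: l))]
      intro t ht
      exact h (z :: t) (by simp [ht])
    · rfl

lemma W_zero (P : V → V → ℝ) (D : Finset V) (n : ℕ) (y : V) :
    W P D n y (fun _ => 0) = 0 := by
  induction n generalizing y with
  | zero => simp [W]
  | succ n ih => simp [W, ih]

lemma W_zero' (P : V → V → ℝ) (D : Finset V) (n : ℕ) (y : V) (φ : List V → ℝ)
    (h : ∀ t : List V, t.length = n → φ (y :: t) = 0) : W P D n y φ = 0 := by
  rw [W_congr P D n y φ (fun _ => 0) h, W_zero]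

lemma W_of_not_mem (P : V → V → ℝ) (D : Finset V) (n : ℕ) (y : V) (φ : List V → ℝ)
    (h : y ∉ D) : W P D n y φ = 0 := by
  cases n <;> simp [W, h]

lemma W_sum {ι : Type*} (s : Finset ι) (P : V → V → ℝ) (D : Finset V) (n : ℕ) (y : V)
    (φ : ι → List V → ℝ) :
    W P D n y (fun l => ∑ i ∈ s, φ i l) = ∑ i ∈ s, W P D n y (φ i) := by
  induction n generalizing y φ with
  | zero => by_cases h : y ∈ D <;> simp [W, h]
  | succ n ih =>
    by_cases h : y ∈ D
    · simp only [W, h, if_true]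
      rw [Finset.sum_comm]
      refine Finset.sum_congr rfl fun z _ => ?_
      rw [ih z (fun i l => φ i (y :: l)), Finset.mul_sum]
    · simp [W, h]

lemma W_add (P : V → V → ℝ) (D : Finset V) (n : ℕ) (y : V) (φ ψ : List V → ℝ) :
    W P D n y (fun l => φ l + ψ l) = W P D n y φ + W P D n y ψ := by
  have := W_sum (Finset.univ : Finset Bool) P D n y (fun i => if i then φ else ψ)
  simpa using this

lemma W_mul (P : V → V → ℝ) (D : Finset V) (n : ℕ) (y : V) (c : ℝ) (φ : List V → ℝ) :
    W P D n y (fun l => c * φ l) = c * W P D n y φ := by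
  induction n generalizing y φ with
  | zero => by_cases h : y ∈ D <;> simp [W, h]
  | succ n ih =>
    by_cases h : y ∈ D
    · simp only [W, h, if_true]
      rw [Finset.mul_sum]
      refine Finset.sum_congr rfl fun z _ => ?_
      rw [ih z (fun l => φ (y :: l))]
      ring
    · simp [W, h]

lemma W_avoid (P : V → V → ℝ) (D : Finset V) (n : ℕ) (y c : V) (φ : List V → ℝ) :
    W P D n c (fun l => if y ∈ l then 0 else φ l) = W P (D.erase y) n c φ := by
  by_cases hc : c = y
  · subst hc
    rw [W_of_not_mem P (D.erase c) _ _ _ (by simp)]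
    exact W_zero' _ _ _ _ _ (by simp)
  induction n generalizing c φ with
  | zero => simp [W, hc, Ne.symm hc]
  | succ n ih =>
    simp only [W, Finset.mem_erase, ne_eq, hc, not_false_eq_true, true_and, List.mem_cons,
      Ne.symm hc, false_or]
    split_ifs
    · refine Finset.sum_congr rfl fun z _ => ?_
      by_cases hz : z = y
      · subst hz
        rw [W_of_not_mem P (D.erase z) _ _ _ (by simp), W_zero' _ _ _ _ _ (by simp)]
      · rw [ih z (fun l => φ (c :: l)) hz]
    · rfl

/-- Row-masked matrix. -/
def PD (P : V → V → ℝ) (D : Finset V) : Matrix V V ℝ :=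
  Matrix.of fun a c => if a ∈ D then P a c else 0

/-- Part after the last visit. -/
def U (P : V → V → ℝ) (D : Finset V) (y : V) (φ : List V → ℝ) : ℕ → ℝ
  | 0 => φ []
  | j + 1 => ∑ c, P y c * W P (D.erase y) j c φ

lemma W_last (P : V → V → ℝ) (D : Finset V) (y : V) (hy : y ∈ D) (φ : List V → ℝ) (n : ℕ) (z : V) :
    W P D n z (fun l => if y ∈ l then φ (dropToLastOcc y l) else 0) =
      ∑ p ∈ Finset.HasAntidiagonal.antidiagonal n, (PD P D ^ p.1) z y * U P D y φ p.2 := by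
  induction n generalizing z with
  | zero =>
    by_cases h : z = y
    · subst h
      simp [W, hy, U, drop_cons_self, drop_nil]
    · simp [W, U, h, Ne.symm h]
  | succ n ih =>
    rw [Finset.Nat.sum_antidiagonal_succ]
    have e1 : W P D (n + 1) z (fun l => if y ∈ l then φ (dropToLastOcc y l) else 0) =
        (if z ∈ D then ∑ c, P z c * W P D n c
          (fun l => if y ∈ l then φ (dropToLastOcc y l) else 0) else 0) +
        (if z = y then ∑ c, P y c * W P (D.erase y) n c φ else 0) := by
      simp only [W]
      by_cases hz : z ∈ D
      · simp only [hz, if_true]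
        by_cases hzy : z = y
        · subst hzy
          simp only [if_true]
          rw [← Finset.sum_add_distrib]
          refine Finset.sum_congr rfl fun c _ => ?_
          rw [← mul_add, ← W_avoid, ← W_add]
          congr 1
          refine W_congr _ _ _ _ _ _ fun t _ => ?_
          by_cases h : z ∈ c :: t
          · simp only [h, List.mem_cons_of_mem, if_true, drop_cons_self, add_zero]
          · simp only [h, List.mem_cons_self, if_true, if_false, drop_cons_self, zero_add,
              drop_of_not_mem _ _ h]
        · simp only [hzy, if_false, add_zero]
          refine Finset.sum_congr rfl fun c _ => ?_
          congr 1
          refine W_congr _ _ _ _ _ _ fun t _ => ?_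
          by_cases h : y ∈ c :: t
          · rw [if_pos h, if_pos (List.mem_cons_of_mem _ h), drop_cons_of_mem _ _ _ h]
          · rw [if_neg h, if_neg]
            rw [List.mem_cons]
            rintro (h' | h')
            · exact hzy h'.symm
            · exact h h'
      · have : z ≠ y := fun h => hz (h ▸ hy)
        simp [hz, this]
    rw [e1, add_comm]
    congr 1
    · by_cases h : z = y
      · subst h; simp [U]
      · simp [h]
    · simp only [ih]
      simp only [pow_succ', Matrix.mul_apply, PD, Matrix.of_apply]
      by_cases hz : z ∈ D
      · simp only [hz, if_true, Finset.mul_sum, Finset.sum_mul]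
        rw [Finset.sum_comm]
        simp only [mul_assoc]
      · simp [hz]

open PowerSeries in
/-- `1 - X P_D`. -/
noncomputable def MD (P : V → V → ℝ) (D : Finset V) : Matrix V V (PowerSeries ℝ) :=
  1 - (PowerSeries.X : PowerSeries ℝ) • (PD P D).map (PowerSeries.C)

/-- Green function series. -/
noncomputable def GD (P : V → V → ℝ) (D : Finset V) : Matrix V V (PowerSeries ℝ) :=
  Matrix.of fun a c => PowerSeries.mk fun n => (PD P D ^ n) a c

lemma MD_mul_GD (P : V → V → ℝ) (D : Finset V) : MD P D * GD P D = 1 := by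
  rw [MD, sub_mul, one_mul, sub_eq_iff_eq_add, Matrix.smul_mul]
  ext a c n
  simp only [Matrix.add_apply, Matrix.smul_apply, Matrix.mul_apply, map_add, smul_eq_mul,
    Matrix.map_apply, GD, Matrix.of_apply, PowerSeries.coeff_mk]
  cases n with
  | zero =>
    by_cases h : a = c <;> simp [Matrix.one_apply, h]
  | succ n =>
    rw [PowerSeries.coeff_succ_X_mul, pow_succ', Matrix.mul_apply, map_sum]
    by_cases h : a = c <;> simp [Matrix.one_apply, h, PowerSeries.coeff_one]

lemma MD_erase (P : V → V → ℝ) (D : Finset V) (y : V) :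
    MD P (D.erase y) = (MD P D).updateRow y (Pi.single y 1) := by
  ext1 a c
  by_cases h : a = y
  · subst h
    by_cases h' : a = c
    · subst h'; simp [MD, PD]
    · simp [MD, PD, h', Matrix.one_apply, Pi.single_apply, Ne.symm h']
  · rw [Matrix.updateRow_ne h]
    simp [MD, PD, h]

lemma GD_mul_det (P : V → V → ℝ) (D : Finset V) (y : V) :
    GD P D y y * (MD P D).det = (MD P (D.erase y)).det := by
  rw [MD_erase, ← Matrix.adjugate_apply]
  have : (MD P D).adjugate = (MD P D).det • GD P D := by
    calc (MD P D).adjugate = (MD P D).adjugate * (MD P D * GD P D) := by rw [MD_mul_GD, mul_one]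
      _ = _ := by rw [← mul_assoc, Matrix.adjugate_mul]; simp
  rw [this]
  simp [mul_comm]

lemma MD_det_ne_zero (P : V → V → ℝ) (D : Finset V) : (MD P D).det ≠ 0 := by
  intro h
  have := congrArg Matrix.det (MD_mul_GD P D)
  rw [Matrix.det_mul, h] at this
  simp at this

lemma MD_det_transpose (P : V → V → ℝ) (D : Finset V) :
    (MD (fun a c => P c a) D).det = (MD P D).det := by
  let E : Matrix V V (PowerSeries ℝ) := Matrix.diagonal fun a => if a ∈ D then 1 else 0
  have key : ∀ Q : V → V → ℝ, MD Q D =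
      1 - E * ((PowerSeries.X : PowerSeries ℝ) • (Matrix.of Q).map (PowerSeries.C)) := by
    intro Q
    unfold MD
    congr 1
    ext1 a c
    by_cases h : a ∈ D <;> simp [E, PD, h, Matrix.diagonal_mul]
  rw [key, key, Matrix.det_one_sub_mul_comm, ← Matrix.det_transpose]
  congr 1
  rw [Matrix.transpose_sub, Matrix.transpose_mul, Matrix.transpose_one]
  congr 2
  simp [E]

/-- Product of the weights along a path. -/
def cw (P : V → V → ℝ) : List V → ℝ
  | [] => 1
  | [_] => 1
  | a :: c :: l => P a c * cw P (c :: l)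

lemma cw_append (P : V → V → ℝ) (l : List V) (a : V) (r : List V) :
    cw P (l ++ a :: r) = cw P (l ++ [a]) * cw P (a :: r) := by
  induction l with
  | nil => simp [cw]
  | cons c l ih =>
    cases l with
    | nil => simp [cw]
    | cons d l =>
      simp only [List.cons_append] at ih ⊢
      simp only [cw]
      rw [ih, mul_assoc]

lemma cw_reverse (P : V → V → ℝ) (l : List V) :
    cw (fun a c => P c a) l.reverse = cw P l := by
  induction l with
  | nil => simp [cw]
  | cons a l ih =>
    cases l with
    | nil => simp [cw]
    | cons c l =>
      rw [List.reverse_cons, List.reverse_cons, List.append_assoc, List.singleton_append,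
        cw_append, ← List.reverse_cons, ih]
      simp [cw, mul_comm]

/-- Right-hand side of the product formula. -/
noncomputable def RHS (P : V → V → ℝ) (D : Finset V) (w : List V) : PowerSeries ℝ :=
  if w.Nodup ∧ (∀ a ∈ w, a ∈ D) then
    PowerSeries.C (cw P w) * PowerSeries.X ^ (w.length - 1) * (MD P (D \ w.toFinset)).det
  else 0

lemma LE_cons' (y : V) (l : List V) : LE (y :: l) = y :: LE (dropToLastOcc y (y :: l)) := by
  rw [LE_cons, drop_cons_self]

lemma W_head_zero (P : V → V → ℝ) (D : Finset V) (n : ℕ) (z c : V) (w : List V)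
    (f : List V → List V) (hf : ∀ z t, ∃ s, f (z :: t) = z :: s) (h : z ≠ c) :
    W P D n z (fun l => if f l = c :: w then 1 else 0) = 0 := by
  refine W_zero' _ _ _ _ _ fun t _ => ?_
  obtain ⟨s, hs⟩ := hf z t
  rw [hs, if_neg]
  intro h'
  exact h (List.cons.inj h').1

lemma LE_head : ∀ (z : V) (t : List V), ∃ s, LE (z :: t) = z :: s :=
  fun z t => ⟨_, LE_cons z t⟩

lemma BLE_head : ∀ (z : V) (t : List V), ∃ s, BLE (z :: t) = z :: s :=
  fun z t => ⟨_, BLE_cons z t⟩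

lemma W_split (P : V → V → ℝ) (D : Finset V) (n : ℕ) (y : V) (hy : y ∈ D) (φ : List V → ℝ)
    (f : List V → List V) (hf : ∀ t, f (y :: t) = y :: f (dropToLastOcc y (y :: t))) :
    W P D n y (fun l => φ (f l)) =
      ∑ p ∈ Finset.HasAntidiagonal.antidiagonal n, (PD P D ^ p.1) y y *
        U P D y (fun l => φ (y :: f l)) p.2 := by
  rw [← W_last P D y hy]
  refine W_congr _ _ _ _ _ _ fun t _ => ?_
  rw [hf, if_pos (by simp)]

lemma LE_series (P : V → V → ℝ) (D : Finset V) (y : V) (w : List V) :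
    (PowerSeries.mk fun n => W P D n y (fun l => if LE l = y :: w then 1 else 0)) * (MD P D).det
      = RHS P D (y :: w) := by
  induction w generalizing D y with
  | nil =>
    by_cases hy : y ∈ D
    · have e : (PowerSeries.mk fun n => W P D n y (fun l => if LE l = [y] then 1 else 0))
          = GD P D y y := by
        ext n
        rw [PowerSeries.coeff_mk, W_split P D n y hy (fun l => if l = [y] then 1 else 0) LE
          (LE_cons' y)]
        simp only [GD, Matrix.of_apply, PowerSeries.coeff_mk]
        have hU : ∀ j, U P D y (fun l => if y :: LE l = [y] then (1 : ℝ) else 0) j =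
            if j = 0 then 1 else 0 := by
          intro j
          cases j with
          | zero => simp [U, LE_nil]
          | succ j =>
            simp only [U]
            rw [Finset.sum_eq_zero]
            · simp
            · intro c _
              rw [W_zero', mul_zero]
              intro t _
              simp [LE_cons]
        simp only [hU]
        rw [Finset.sum_eq_single (n, 0)]
        · simp
        · rintro ⟨i, j⟩ hij hne
          have : j ≠ 0 := by
            rintro rfl
            simp at hij
            exact hne (by rw [hij])
          simp [this]
        · simp
      rw [e, GD_mul_det]
      simp [RHS, hy, cw, Finset.sdiff_singleton_eq_erase]
    · simp only [W_of_not_mem P D _ y _ hy]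
      simp only [RHS, List.mem_cons, forall_eq_or_imp, hy, false_and, and_false, if_false]
      rw [show (PowerSeries.mk fun _ : ℕ => (0 : ℝ)) = 0 from rfl, zero_mul]
  | cons c w ih =>
    by_cases hy : y ∈ D
    · have e : (PowerSeries.mk fun n => W P D n y (fun l => if LE l = y :: c :: w then 1 else 0))
          = GD P D y y * (PowerSeries.X * (PowerSeries.C (P y c) *
            PowerSeries.mk fun n => W P (D.erase y) n c
              (fun l => if LE l = c :: w then 1 else 0))) := by
        ext n
        rw [PowerSeries.coeff_mk, W_split P D n y hy (fun l => if l = y :: c :: w then 1 else 0) LE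
          (LE_cons' y), PowerSeries.coeff_mul]
        refine Finset.sum_congr rfl ?_
        rintro ⟨i, j⟩ _
        simp only [GD, Matrix.of_apply, PowerSeries.coeff_mk]
        congr 1
        cases j with
        | zero => simp [U, LE_nil]
        | succ j =>
          rw [PowerSeries.coeff_succ_X_mul, PowerSeries.coeff_C_mul, PowerSeries.coeff_mk]
          simp only [U, List.cons.injEq, true_and]
          rw [Finset.sum_eq_single c]
          · intro z _ hz
            rw [W_head_zero P _ j z c w LE LE_head hz, mul_zero]
          · simp
      have h2 := ih (D.erase y) c
      rw [e]
      calc _ = (GD P D y y * (MD P D).det) * (PowerSeries.X * (PowerSeries.C (P y c) *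
            PowerSeries.mk fun n => W P (D.erase y) n c
              (fun l => if LE l = c :: w then 1 else 0))) := by ring
        _ = PowerSeries.X * PowerSeries.C (P y c) * RHS P (D.erase y) (c :: w) := by
          rw [GD_mul_det, ← h2]; ring
        _ = _ := by
          have hiff : ((c :: w).Nodup ∧ ∀ a ∈ c :: w, a ∈ D.erase y) ↔
              ((y :: c :: w).Nodup ∧ ∀ a ∈ y :: c :: w, a ∈ D) := by
            rw [List.nodup_cons (a := y)]
            constructor
            · rintro ⟨h1, h2⟩
              refine ⟨⟨fun h => ?_, h1⟩, ?_⟩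
              · simpa using h2 y h
              · intro a ha
                rcases List.mem_cons.1 ha with rfl | ha
                · exact hy
                · exact Finset.mem_of_mem_erase (h2 a ha)
            · rintro ⟨⟨h1, h2⟩, h3⟩
              refine ⟨h2, fun a ha => Finset.mem_erase.2 ⟨?_, h3 a (List.mem_cons_of_mem _ ha)⟩⟩
              rintro rfl
              exact h1 ha
          have hset : D.erase y \ (c :: w).toFinset = D \ (y :: c :: w).toFinset := by
            ext a; simp; tauto
          unfold RHS
          simp only [hiff, hset]
          split_ifs
          · simp only [cw, map_mul, List.length_cons, Nat.add_sub_cancel]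
            ring
          · simp
    · simp only [W_of_not_mem P D _ y _ hy]
      simp only [RHS, List.mem_cons, forall_eq_or_imp, hy, false_and, and_false, if_false]
      rw [show (PowerSeries.mk fun _ : ℕ => (0 : ℝ)) = 0 from rfl, zero_mul]

lemma W_total (P : V → V → ℝ) (D : Finset V) (n : ℕ) (c : V) (w : List V)
    (f : List V → List V) (hf : ∀ z t, ∃ s, f (z :: t) = z :: s) :
    ∑ z, W P D n z (fun l => if f l = c :: w then 1 else 0) =
      W P D n c (fun l => if f l = c :: w then 1 else 0) := by
  rw [Finset.sum_eq_single c]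
  · intro z _ hz
    exact W_head_zero P _ n z c w f hf hz
  · simp

lemma LE_series' (P : V → V → ℝ) (D : Finset V) (w : List V) (hw : w ≠ []) :
    (PowerSeries.mk fun n => ∑ z, W P D n z (fun l => if LE l = w then 1 else 0)) * (MD P D).det
      = RHS P D w := by
  cases w with
  | nil => exact absurd rfl hw
  | cons c w =>
    rw [← LE_series]
    simp only [W_total P D _ c w LE LE_head]

lemma W_snoc (P : V → V → ℝ) (D : Finset V) (n : ℕ) (y : V) (φ : List V → ℝ) :
    W P D (n + 1) y φ = W P D n y (fun l =>
      ∑ z, if z ∈ D then l.getLast?.elim 0 (fun a => P a z) * φ (l ++ [z]) else 0) := by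
  induction n generalizing y φ with
  | zero => simp [W]
  | succ n ih =>
    rw [W]
    conv_rhs => rw [W]
    split_ifs
    · refine Finset.sum_congr rfl fun c _ => ?_
      rw [ih]
      congr 1
      refine W_congr _ _ _ _ _ _ fun t _ => ?_
      simp [List.getLast?_cons]
    · rfl

lemma W_rev (P : V → V → ℝ) (D : Finset V) (n : ℕ) (φ : List V → ℝ) :
    ∑ z, W P D n z φ = ∑ z, W (fun a c => P c a) D n z (fun l => φ l.reverse) := by
  induction n generalizing φ with
  | zero => simp [W]
  | succ n ih =>
    simp only [W_snoc P]
    rw [ih]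
    have e : ∀ c, W (fun a c => P c a) D n c (fun l => ∑ z, if z ∈ D then
        l.reverse.getLast?.elim 0 (fun a => P a z) * φ (l.reverse ++ [z]) else 0) =
        ∑ z, if z ∈ D then P c z * W (fun a c => P c a) D n c (fun l => φ (z :: l).reverse)
          else 0 := by
      intro c
      rw [W_sum]
      refine Finset.sum_congr rfl fun z _ => ?_
      split_ifs
      · rw [← W_mul]
        refine W_congr _ _ _ _ _ _ fun t _ => ?_
        simp
      · exact W_zero _ _ _ _
    simp only [e]
    rw [Finset.sum_comm]
    refine Finset.sum_congr rfl fun z _ => ?_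
    rw [W]
    split_ifs <;> simp

lemma RHS_rev (P : V → V → ℝ) (D : Finset V) (w : List V) :
    RHS (fun a c => P c a) D w.reverse = RHS P D w := by
  unfold RHS
  simp only [cw_reverse, MD_det_transpose, List.nodup_reverse, List.mem_reverse,
    List.length_reverse, List.toFinset_reverse]

lemma LE_BLE_ind (P : V → V → ℝ) (D : Finset V) (n : ℕ) (y : V) (w : List V) :
    W P D n y (fun l => if LE l = w then 1 else 0) =
      W P D n y (fun l => if BLE l = w then 1 else 0) := by
  cases w with
  | nil =>
    rw [W_zero', W_zero']
    · intro t _; simp [BLE_cons, bstep]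
    · intro t _; simp [LE_cons]
  | cons c w =>
    by_cases h : y = c
    · subst h
      rw [← W_total P D n y w LE LE_head, ← W_total P D n y w BLE BLE_head, W_rev P D n
        (fun l => if BLE l = y :: w then 1 else 0)]
      have h1 := LE_series' P D (y :: w) (by simp)
      have h2 := LE_series' (fun a c => P c a) D (y :: w).reverse (by simp)
      rw [RHS_rev, ← h1, MD_det_transpose] at h2
      have h3 := congrArg (PowerSeries.coeff n) (mul_right_cancel₀ (MD_det_ne_zero P D) h2)
      simp only [PowerSeries.coeff_mk] at h3
      rw [← h3]
      simp only [BLE, List.reverse_reverse, List.reverse_eq_iff]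
    · rw [W_head_zero P D n y c w LE LE_head h, W_head_zero P D n y c w BLE BLE_head h]

lemma W_expand (P : V → V → ℝ) (D : Finset V) (n : ℕ) (y : V) (f : List V → List V)
    (hf : ∀ l, (f l).length ≤ l.length) (φ : List V → ℝ) :
    W P D n y (fun l => φ (f l)) = ∑ w ∈ (List.finite_length_le V (n + 1)).toFinset,
      φ w * W P D n y (fun l => if f l = w then 1 else 0) := by
  simp only [← W_mul]
  rw [← W_sum]
  refine W_congr _ _ _ _ _ _ fun t ht => ?_
  simp only [mul_ite, mul_one, mul_zero]
  rw [Finset.sum_ite_eq, if_pos]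
  have := hf (y :: t)
  simp at this ⊢
  omega

lemma LE_BLE (P : V → V → ℝ) (D : Finset V) (n : ℕ) (y : V) (φ : List V → ℝ) :
    W P D n y (fun l => φ (LE l)) = W P D n y (fun l => φ (BLE l)) := by
  rw [W_expand P D n y LE (fun l => PLE_length _ l) φ, W_expand P D n y BLE _ φ]
  · simp only [LE_BLE_ind]
  · intro l
    unfold BLE
    have := PLE_length Finset.univ l.reverse
    simpa [LE] using this

lemma LE_QLE (P : V → V → ℝ) (b : V) (n : ℕ) (D : Finset V) (y : V) (φ : List V → ℝ) :
    W P D n y (fun l => φ (QLE b l)) = W P D n y (fun l => φ (LE l)) := by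
  induction n using Nat.strong_induction_on generalizing D y φ with
  | _ n ih =>
    by_cases hy : y ∈ D
    swap
    · rw [W_of_not_mem _ _ _ _ _ hy, W_of_not_mem _ _ _ _ _ hy]
    by_cases hb : y = b
    · subst hb
      cases n with
      | zero => simp [W, QLE, LE_nil, LE_cons, PLE_cons, drop_nil, PLE_nil]
      | succ n =>
        rw [LE_BLE]
        simp only [W, QLE_cons_self, BLE_cons]
        rw [if_pos hy, if_pos hy]
        refine Finset.sum_congr rfl fun z _ => ?_
        rw [ih n (by omega) D z (fun l => φ (bstep y l)), LE_BLE P D n z (fun l => φ (bstep y l))]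
    · rw [W_split P D n y hy φ LE (LE_cons' y), W_split P D n y hy φ (QLE b)]
      · refine Finset.sum_congr rfl ?_
        rintro ⟨i, j⟩ hij
        rw [Finset.HasAntidiagonal.mem_antidiagonal] at hij; dsimp only at hij
        congr 1
        cases j with
        | zero => simp [U, QLE, PLE_nil, LE_nil]
        | succ j =>
          simp only [U]
          refine Finset.sum_congr rfl fun z _ => ?_
          rw [ih j (by omega) _ z (fun l => φ (y :: l))]
      · intro t
        rw [QLE_cons_ne b y hb, drop_cons_self]

lemma W_mask (P : V → V → ℝ) (A D : Finset V) (n : ℕ) (y : V) (ψ : List V → ℝ) :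
    W P D n y (fun l => if ∀ a ∈ l.dropLast, a ∉ A then ψ l else 0) =
      W (fun a c => if a ∈ A then 0 else P a c) D n y ψ := by
  induction n generalizing y ψ with
  | zero => simp [W]
  | succ n ih =>
    simp only [W]
    split_ifs with h1 h2
    · simp only [zero_mul, Finset.sum_const_zero]
      refine Finset.sum_eq_zero fun z _ => ?_
      rw [W_zero', mul_zero]
      intro t _
      rw [if_neg]
      intro h
      exact h y (by simp) h2
    · refine Finset.sum_congr rfl fun z _ => ?_
      rw [← ih]
      congr 1
      refine W_congr _ _ _ _ _ _ fun t _ => ?_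
      simp [h2]
    · rfl

lemma W_explicit (P : V → V → ℝ) (n : ℕ) (y : V) (φ : List V → ℝ) :
    W P Finset.univ n y φ = ∑ v : Fin (n + 1) → V,
      ((if y = v 0 then 1 else 0) * ∏ i : Fin n, P (v i.castSucc) (v i.succ)) *
        φ (List.ofFn v) := by
  induction n generalizing y φ with
  | zero =>
    rw [← (Fin.consEquiv (fun _ : Fin 1 => V)).sum_comp, Fintype.sum_prod_type]
    simp [W, Fin.consEquiv]
  | succ n ih =>
    rw [← (Fin.consEquiv (fun _ : Fin (n + 2) => V)).sum_comp, Fintype.sum_prod_type]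
    rw [Finset.sum_eq_single y]
    · simp only [W, Finset.mem_univ, if_true, ih, Finset.mul_sum]
      rw [Finset.sum_comm]
      refine Finset.sum_congr rfl fun v _ => ?_
      rw [Finset.sum_eq_single (v 0)]
      · simp only [Fin.consEquiv, Equiv.coe_fn_mk, Fin.cons_zero, if_true, one_mul,
          Fin.prod_univ_succ (n := n), Fin.castSucc_zero, Fin.cons_succ, List.ofFn_succ (n := n + 1)]
        simp only [← Fin.succ_castSucc, Fin.cons_succ]
        ring
      · intro z _ hz; simp [hz]
      · simp
    · intro z _ hz
      simp [Fin.consEquiv, Ne.symm hz]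
    · simp

lemma prod_Icc_fin (f : ℕ → ℝ) (n : ℕ) :
    ∏ i ∈ Finset.Icc 1 n, f i = ∏ i : Fin n, f (i + 1) := by
  rw [← Finset.prod_range (fun i => f (i + 1))]
  induction n with
  | zero => simp
  | succ n ih => rw [Finset.prod_Icc_succ_top (by omega), ih, Finset.prod_range_succ]

/-- Extension of a finite tuple. -/
def ext0 (n : ℕ) (v : Fin (n + 1) → V) (i : ℕ) : V :=
  if h : i < n + 1 then v ⟨i, h⟩ else v 0

variable [MeasurableSpace V] [MeasurableSingletonClass V]

lemma cyl_meas (n : ℕ) (y : ℕ → V) : MeasurableSet {ω : ℕ → V | ∀ i ≤ n, ω i = y i} := by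
  have : {ω : ℕ → V | ∀ i ≤ n, ω i = y i} = ⋂ i, ⋂ (_ : i ≤ n), (fun ω : ℕ → V => ω i) ⁻¹' {y i} := by
    ext ω; simp
  rw [this]
  exact MeasurableSet.iInter fun i => MeasurableSet.iInter fun _ =>
    measurable_pi_apply i (measurableSet_singleton _)

lemma prefix_eq (n : ℕ) (ω : ℕ → V) (v : Fin (n + 1) → V) :
    (∀ i ≤ n, ω i = ext0 n v i) ↔ v = fun i : Fin (n + 1) => ω i := by
  constructor
  · intro h
    funext i
    rw [h i (by omega), ext0, dif_pos i.2]
  · rintro rfl i hi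
    simp [ext0, Nat.lt_succ_of_le hi]

lemma prefix_set (n : ℕ) (p : List V → Prop) [DecidablePred p] :
    {ω : ℕ → V | p ((List.range (n + 1)).map ω)} =
      ⋃ v ∈ (Finset.univ.filter fun v : Fin (n + 1) → V => p (List.ofFn v)),
        {ω : ℕ → V | ∀ i ≤ n, ω i = ext0 n v i} := by
  ext ω
  have hl : (List.range (n + 1)).map ω = List.ofFn (fun i : Fin (n + 1) => ω i) := by
    rw [List.ofFn_eq_map, ← List.map_coe_finRange_eq_range, List.map_map]
    rfl
  simp only [Set.mem_ofPred_eq, Set.mem_iUnion, prefix_eq, Finset.mem_filter, Finset.mem_univ,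
    true_and, hl]
  simp

lemma prefix_meas (n : ℕ) (p : List V → Prop) [DecidablePred p] :
    MeasurableSet {ω : ℕ → V | p ((List.range (n + 1)).map ω)} := by
  rw [prefix_set]
  exact Finset.measurableSet_biUnion _ fun v _ => cyl_meas n _

lemma prefix_measure (P : V → V → ℝ) (μ : V → Measure (ℕ → V))
    (hP0 : ∀ a b : V, 0 ≤ P a b)
    (hlaw : ∀ (a : V) (n : ℕ) (y : ℕ → V),
      μ a {ω | ∀ i ≤ n, ω i = y i} =
        ENNReal.ofReal ((if a = y 0 then (1 : ℝ) else 0) *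
          ∏ i ∈ Finset.Icc 1 n, P (y (i - 1)) (y i)))
    (x : V) (n : ℕ) (p : List V → Prop) [DecidablePred p] :
    μ x {ω : ℕ → V | p ((List.range (n + 1)).map ω)} =
      ENNReal.ofReal (W P Finset.univ n x (fun l => if p l then 1 else 0)) := by
  rw [prefix_set, measure_biUnion_finset _ fun v _ => cyl_meas n _]
  · simp only [hlaw]
    rw [W_explicit, Finset.sum_filter, ENNReal.ofReal_sum_of_nonneg]
    · refine Finset.sum_congr rfl fun v _ => ?_
      have e0 : ext0 n v 0 = v 0 := by simp [ext0]
      have e1 : ∏ i ∈ Finset.Icc 1 n, P (ext0 n v (i - 1)) (ext0 n v i) =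
          ∏ i : Fin n, P (v i.castSucc) (v i.succ) := by
        rw [prod_Icc_fin (fun i => P (ext0 n v (i - 1)) (ext0 n v i))]
        refine Finset.prod_congr rfl fun i _ => ?_
        have h1 : (i : ℕ) < n + 1 := by omega
        have h2 : (i : ℕ) + 1 < n + 1 := by omega
        simp only [Nat.add_sub_cancel, ext0]
        rw [dif_pos h1, dif_pos h2]
        rfl
      rw [e0, e1]
      by_cases hp : p (List.ofFn v)
      · rw [if_pos hp, if_pos hp, mul_one]
      · rw [if_neg hp, if_neg hp, mul_zero, ENNReal.ofReal_zero]
    · intro v _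
      refine mul_nonneg (mul_nonneg ?_ (Finset.prod_nonneg fun i _ => hP0 _ _)) ?_ <;>
        split_ifs <;> norm_num
  · intro v _ v' _ hne
    refine Set.disjoint_left.2 fun ω h h' => hne ?_
    rw [Set.mem_ofPred_eq, prefix_eq] at h h'
    rw [h, h']

/-- The stopped-path event as a prefix event. -/
def stopP (A : Finset V) (f : List V → List V) (w l : List V) : Prop :=
  (∀ a ∈ l.dropLast, a ∉ A) ∧ (∃ a ∈ l.getLast?, a ∈ A) ∧ f l = w

lemma stop_iff (A : Finset V) (f : List V → List V) (w : List V) (ω : ℕ → V) (n : ℕ) :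
    stopP A f w ((List.range (n + 1)).map ω) ↔
      ((∀ i < n, ω i ∉ A) ∧ ω n ∈ A) ∧ f ((List.range (n + 1)).map ω) = w := by
  unfold stopP
  rw [← and_assoc]
  simp [List.range_succ]

lemma stop_set (A : Finset V) (f : List V → List V) (w : List V) :
    {ω : ℕ → V | (∃ n : ℕ, ω n ∈ A) ∧ f (stoppedPath A ω) = w} =
      ⋃ n, {ω : ℕ → V | stopP A f w ((List.range (n + 1)).map ω)} := by
  ext ω
  simp only [Set.mem_iUnion, Set.mem_ofPred_eq, stop_iff]
  constructor
  · rintro ⟨h, h'⟩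
    refine ⟨entryTimeNat A ω, ⟨fun i hi => ?_, Nat.sInf_mem h⟩, h'⟩
    exact Nat.notMem_of_lt_sInf hi
  · rintro ⟨n, ⟨h1, h2⟩, h3⟩
    have : entryTimeNat A ω = n := by
      apply le_antisymm
      · exact Nat.sInf_le h2
      · by_contra hlt
        push Not at hlt
        exact h1 _ hlt (Nat.sInf_mem (s := {n | ω n ∈ A}) ⟨n, h2⟩)
    refine ⟨⟨n, h2⟩, ?_⟩
    rw [stoppedPath, this, h3]

open Classical in
/-- The indicator functional. -/
noncomputable def stopphi (A : Finset V) (w m : List V) : ℝ :=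
  if (∃ a ∈ m.getLast?, a ∈ A) ∧ m = w then 1 else 0

open Classical in
lemma stop_measure (P : V → V → ℝ) (μ : V → Measure (ℕ → V))
    (hP0 : ∀ a b : V, 0 ≤ P a b)
    (hlaw : ∀ (a : V) (n : ℕ) (y : ℕ → V),
      μ a {ω | ∀ i ≤ n, ω i = y i} =
        ENNReal.ofReal ((if a = y 0 then (1 : ℝ) else 0) *
          ∏ i ∈ Finset.Icc 1 n, P (y (i - 1)) (y i)))
    (A : Finset V) (x : V) (f : List V → List V)
    (hf : ∀ l, (f l).getLast? = l.getLast?) (w : List V) :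
    μ x {ω : ℕ → V | (∃ n : ℕ, ω n ∈ A) ∧ f (stoppedPath A ω) = w} =
      ∑' n, ENNReal.ofReal (W (fun a c => if a ∈ A then 0 else P a c) Finset.univ n x
        (fun l => stopphi A w (f l))) := by
  rw [stop_set, measure_iUnion]
  · congr 1
    funext n
    rw [prefix_measure P μ hP0 hlaw x n, ← W_mask]
    congr 1
    refine W_congr _ _ _ _ _ _ fun t _ => ?_
    simp only [hf, stopphi]
    by_cases h1 : ∀ a ∈ (x :: t).dropLast, a ∉ A
    · rw [if_pos h1]
      by_cases h2 : (∃ a ∈ (x :: t).getLast?, a ∈ A) ∧ f (x :: t) = w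
      · rw [if_pos h2, if_pos (show stopP A f w (x :: t) from ⟨h1, h2⟩)]
      · rw [if_neg h2, if_neg (fun h : stopP A f w (x :: t) => h2 h.2)]
    · rw [if_neg h1, if_neg (fun h : stopP A f w (x :: t) => h1 h.1)]
  · intro n m hnm
    refine Set.disjoint_left.2 fun ω h h' => hnm ?_
    rw [Set.mem_ofPred_eq, stop_iff] at h h'
    by_contra hne
    rcases lt_or_gt_of_ne hne with hlt | hlt
    · exact h'.1.1 n hlt h.1.2
    · exact h.1.1 m hlt h'.1.2
  · intro n
    exact prefix_meas n _

end Helpers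

theorem loop_erasure_eq_LE_after_PLE_erase_one_point
    {V : Type*} [Fintype V] [DecidableEq V] [Nonempty V]
    [MeasurableSpace V] [MeasurableSingletonClass V]
    (P : V → V → ℝ) (μ : V → Measure (ℕ → V))
    (hP0 : ∀ a b : V, 0 ≤ P a b) (hP1 : ∀ a : V, ∑ b : V, P a b = 1)
    (hprob : ∀ a : V, IsProbabilityMeasure (μ a))
    (hlaw : ∀ (a : V) (n : ℕ) (y : ℕ → V),
      μ a {ω | ∀ i ≤ n, ω i = y i} =
        ENNReal.ofReal ((if a = y 0 then (1 : ℝ) else 0) *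
          ∏ i ∈ Finset.Icc 1 n, P (y (i - 1)) (y i)))
    (hcard : 2 ≤ Fintype.card V) (b : V)
    (A : Finset V) (x : V)
    (hx : μ x {ω | ∃ n : ℕ, ω n ∈ A} = 1) :
    ∀ w : List V,
      μ x {ω | (∃ n : ℕ, ω n ∈ A) ∧ LE (stoppedPath A ω) = w} =
        μ x {ω | (∃ n : ℕ, ω n ∈ A) ∧
          LE (PLE (Finset.univ \ {b}) (stoppedPath A ω)) = w} := by
  intro w
  have h2 := stop_measure P μ hP0 hlaw A x (QLE b)
    (fun l => by unfold QLE LE; rw [PLE_getLast?, PLE_getLast?]) w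
  simp only [LE_QLE] at h2
  rw [stop_measure P μ hP0 hlaw A x LE (fun l => PLE_getLast? _ l) w]
  exact h2.symm

end LERW
end
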